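/- arXiv:math/0203192 — 8 statements merged into one kernel-verified Lean document; each statement's English description precedes it below -/
import Mathlib

section
/- The Weeks manifold group G = ⟨a, b | b·a·b·a·b·a⁻¹·b²·a⁻¹, a·b·a·b·a·b⁻¹·a²·b⁻¹⟩ is not left-orderable; that is, there is no linear order on G such that g < h implies f·g < f·h for all f, g, h ∈ G. -/
/-- The relations of the Weeks manifold group, as elements of the free group on
two generators `0 ↦ a`, `1 ↦ b`. -/
def weeksRels : Set (FreeGroup (Fin 2)) :=
  { FreeGroup.of 1 * FreeGroup.of 0 * FreeGroup.of 1 * FreeGroup.of 0 * FreeGroup.of 1 *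
      (FreeGroup.of 0)⁻¹ * FreeGroup.of 1 ^ 2 * (FreeGroup.of 0)⁻¹,
    FreeGroup.of 0 * FreeGroup.of 1 * FreeGroup.of 0 * FreeGroup.of 1 * FreeGroup.of 0 *
      (FreeGroup.of 1)⁻¹ * FreeGroup.of 0 ^ 2 * (FreeGroup.of 1)⁻¹ }

/-- The Weeks manifold group `⟨a, b ∣ babab⁻¹A b²A, ababaB a²B⟩`. -/
abbrev WeeksGroup : Type := PresentedGroup weeksRels

/-- A group is left-orderable if it admits a linear order such that left multiplication
is strictly order-preserving. -/
def IsLeftOrderable (G : Type*) [Group G] : Prop :=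
  ∃ _ : LinearOrder G, ∀ f g h : G, g < h → f * g < f * h

/-- No semigroup `P` avoiding `1` and total on nontrivial elements contains `a`. -/
lemma weeks_key {G : Type*} [Group G] (P : G → Prop) (hm : ∀ x y, P x → P y → P (x * y))
    (h1 : ¬ P 1) (ht : ∀ x, x ≠ 1 → P x ∨ P x⁻¹) (a b : G) (hb : b ≠ 1)
    (r1 : b * a * b * a * b * a⁻¹ * b ^ 2 * a⁻¹ = 1)
    (r2 : a * b * a * b * a * b⁻¹ * a ^ 2 * b⁻¹ = 1) (ha : P a) : False := by
  have key : ∀ x, (x = 1 → False) → (P x → False) → (P x⁻¹ → False) → False := by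
    intro x h0 hp hn
    by_cases hx : x = 1
    · exact h0 hx
    · exact (ht x hx).elim hp hn
  rcases ht b hb with hb | hb
  · refine key (b * a⁻¹) ?_ ?_ ?_
    · intro h
      have hba : b = a := mul_inv_eq_one.mp h
      subst hba
      apply h1
      rw [← r1]
      have e : b * b * b * b * b * b⁻¹ * b ^ 2 * b⁻¹ = b * (b * (b * (b * b))) := by
        simp [pow_two, mul_assoc]
      rw [e]
      exact hm _ _ hb (hm _ _ hb (hm _ _ hb (hm _ _ hb hb)))
    · intro h
      apply h1
      rw [← r1]
      have e : b * a * b * a * b * a⁻¹ * b ^ 2 * a⁻¹ =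
          b * (a * (b * (a * ((b * a⁻¹) * (b * (b * a⁻¹)))))) := by
        simp only [pow_two, mul_assoc]
      rw [e]
      exact hm _ _ hb (hm _ _ ha (hm _ _ hb (hm _ _ ha (hm _ _ h (hm _ _ hb h)))))
    · intro h
      apply h1
      rw [← r2]
      have e : a * b * a * b * a * b⁻¹ * a ^ 2 * b⁻¹ =
          a * (b * (a * (b * ((b * a⁻¹)⁻¹ * (a * (b * a⁻¹)⁻¹))))) := by
        simp only [pow_two, mul_assoc, mul_inv_rev, inv_inv]
      rw [e]
      exact hm _ _ ha (hm _ _ hb (hm _ _ ha (hm _ _ hb (hm _ _ h (hm _ _ ha h)))))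
  · -- now `a` and `b⁻¹` are positive
    have s2 : (a * b) * ((a * b) * (a * (b⁻¹ * (a * (a * b⁻¹))))) = 1 := by
      rw [← r2]; simp only [pow_two, mul_assoc]
    have s1 : a * (b⁻¹ * (b⁻¹ * (a * ((a * b)⁻¹ * ((a * b)⁻¹ * b⁻¹))))) = 1 := by
      rw [← inv_one, ← r1]; simp only [pow_two, mul_assoc, mul_inv_rev, inv_inv]
    refine key (a * b) ?_ ?_ ?_
    · intro h
      rw [h, one_mul, one_mul] at s2
      apply h1
      rw [← s2]
      exact hm _ _ ha (hm _ _ hb (hm _ _ ha (hm _ _ ha hb)))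
    · intro h
      apply h1
      rw [← s2]
      exact hm _ _ h (hm _ _ h (hm _ _ ha (hm _ _ hb (hm _ _ ha (hm _ _ ha hb)))))
    · intro h
      apply h1
      rw [← s1]
      exact hm _ _ ha (hm _ _ hb (hm _ _ hb (hm _ _ ha (hm _ _ h (hm _ _ h hb)))))

/-- Each generator survives in the abelian quotient `ℤ/5`. -/
lemma weeks_gen_ne_one (i : Fin 2) : (PresentedGroup.of i : WeeksGroup) ≠ 1 := by
  intro h
  let f : Fin 2 → Multiplicative (ZMod 5) := fun j => Multiplicative.ofAdd (if j = i then 1 else 0)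
  have hf : ∀ r ∈ weeksRels, FreeGroup.lift f r = 1 := by
    intro r hr
    rcases hr with rfl | rfl
    · simp only [map_mul, map_inv, map_pow, FreeGroup.lift_apply_of, f]
      clear h f
      revert i; decide
    · simp only [map_mul, map_inv, map_pow, FreeGroup.lift_apply_of, f]
      clear h f
      revert i; decide
  have h2 := congrArg (PresentedGroup.toGroup hf) h
  rw [PresentedGroup.toGroup.of, map_one] at h2
  simp only [f, if_true] at h2
  revert h2
  decide

theorem weeksGroup_not_leftOrderable : ¬ IsLeftOrderable WeeksGroup := by
  rintro ⟨_, ho⟩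
  have ha := weeks_gen_ne_one 0
  have hb := weeks_gen_ne_one 1
  have r1 := PresentedGroup.one_of_mem (rels := weeksRels) (Set.mem_insert _ _)
  have r2 := PresentedGroup.one_of_mem (rels := weeksRels)
    (Set.mem_insert_of_mem _ (Set.mem_singleton _))
  simp only [map_mul, map_inv, map_pow] at r1 r2
  have hm : ∀ x y : WeeksGroup, 1 < x → 1 < y → 1 < x * y := by
    intro x y hx hy
    have := ho x 1 y hy
    rw [mul_one] at this
    exact hx.trans this
  have ht : ∀ x : WeeksGroup, x ≠ 1 → 1 < x ∨ 1 < x⁻¹ := by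
    intro x hx
    rcases lt_or_gt_of_ne hx with h | h
    · right
      have := ho x⁻¹ x 1 h
      rwa [inv_mul_cancel, mul_one] at this
    · exact Or.inl h
  rcases ht _ ha with h | h
  · exact weeks_key (fun x => 1 < x) hm (lt_irrefl _) ht _ _ hb r1 r2 h
  · refine weeks_key (fun x => 1 < x⁻¹) ?_ ?_ ?_ _ _ hb r1 r2 h
    · intro x y hx hy
      simp only [mul_inv_rev]
      exact hm _ _ hy hx
    · simp
    · intro x hx
      simpa [or_comm] using ht x hx
end

section
/- Every subgroup of index 5 in the Weeks manifold group G is a normal subgroup. -/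
/-- Apply the permutation whose value at `x` is the `x`-th octal digit of `p`. -/
def octApply (p x : ℕ) : ℕ := Nat.mod (Nat.shiftRight p (Nat.mul 3 x)) 8

/-- The permutations of `{0, ..., 4}` in octal coding, each with its inverse. -/
def octPerms : List (ℕ × ℕ) :=
  [(18056, 18056), (14472, 14472), (17608, 17608), (10440, 13576), (13576, 10440), (9992, 9992),
   (18000, 18000), (14416, 14416), (17104, 17496), (6352, 13408), (13072, 10328), (5904, 9824),
   (17496, 17104), (10328, 13072), (17048, 17048), (6296, 12960), (8984, 8984), (5400, 8928),
   (13408, 6352), (9824, 5904), (12960, 6296), (5792, 5792), (8928, 5400), (5344, 5344),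
   (18049, 18049), (14465, 14465), (17601, 17601), (10433, 13569), (13569, 10433), (9985, 9985),
   (17937, 17986), (14353, 14402), (16593, 17475), (2257, 13380), (12561, 10307), (1809, 9796),
   (17433, 17090), (10265, 13058), (16537, 17027), (2201, 12932), (8473, 8963), (1305, 8900),
   (13345, 6338), (9761, 5890), (12449, 6275), (1697, 5764), (8417, 5379), (1249, 5316),
   (17986, 17937), (14402, 14353), (17090, 17433), (6338, 13345), (13058, 10265), (5890, 9761),
   (17930, 17930), (14346, 14346), (16586, 17419), (2250, 13324), (12554, 10251), (1802, 9740),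
   (16922, 16922), (6170, 12834), (16474, 16915), (2138, 12820), (4378, 8739), (794, 8732),
   (12834, 6170), (5666, 5666), (12386, 6163), (1634, 5652), (4322, 5155), (738, 5148),
   (17475, 16593), (10307, 12561), (17027, 16537), (6275, 12449), (8963, 8473), (5379, 8417),
   (17419, 16586), (10251, 12554), (16523, 16523), (2187, 12428), (8459, 8459), (1291, 8396),
   (16915, 16474), (6163, 12386), (16467, 16467), (2131, 12372), (4371, 8291), (787, 8284),
   (8739, 4378), (5155, 4322), (8291, 4371), (1123, 4308), (4259, 4259), (675, 4252),
   (13380, 2257), (9796, 1809), (12932, 2201), (5764, 1697), (8900, 1305), (5316, 1249),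
   (13324, 2250), (9740, 1802), (12428, 2187), (1676, 1676), (8396, 1291), (1228, 1228),
   (12820, 2138), (5652, 1634), (12372, 2131), (1620, 1620), (4308, 1123), (724, 1116),
   (8732, 794), (5148, 738), (8284, 787), (1116, 724), (4252, 675), (668, 668)]

/-- The relator `b a b a b a⁻¹ b² a⁻¹` fixes `x`. Here `p`, `P` code `a`, `a⁻¹` and `q` codes `b`. -/
def octRel (p P q x : ℕ) : Bool :=
  Nat.beq (octApply q (octApply p (octApply q (octApply p (octApply q (octApply P
    (octApply q (octApply q (octApply P x))))))))) x

/-- `x` is a point where the coded permutations commute. -/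
def octComm (p q x : ℕ) : Bool :=
  Nat.beq (octApply p (octApply q x)) (octApply q (octApply p x))

/-- A Boolean test at the five points. -/
def allFive (f : ℕ → Bool) : Bool := f 0 && (f 1 && (f 2 && (f 3 && f 4)))

theorem octPerms_check : (octPerms.all fun u => octPerms.all fun v =>
    !(allFive (octRel u.1 u.2 v.1)) || (!(allFive (octRel v.1 v.2 u.1)) ||
      allFive (octComm u.1 v.1))) = true := by
  decide +kernel

theorem octPerms_complete : ∀ a : Equiv.Perm (Fin 5), ∃ u ∈ octPerms,
    (∀ x : Fin 5, octApply u.1 x = a x) ∧ ∀ x : Fin 5, octApply u.2 x = a⁻¹ x := by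
  decide +kernel

theorem allFive_iff (f : ℕ → Bool) : allFive f = true ↔ ∀ x : Fin 5, f x = true := by
  simp [allFive, Fin.forall_fin_succ]

theorem perm_five_check (a b : Equiv.Perm (Fin 5))
    (h1 : ∀ x, b (a (b (a (b (a⁻¹ (b (b (a⁻¹ x)))))))) = x)
    (h2 : ∀ x, a (b (a (b (a (b⁻¹ (a (a (b⁻¹ x)))))))) = x) (x : Fin 5) :
    a (b x) = b (a x) := by
  obtain ⟨u, hu, ua, ua'⟩ := octPerms_complete a
  obtain ⟨v, hv, vb, vb'⟩ := octPerms_complete b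
  have h := List.all_eq_true.1 (List.all_eq_true.1 octPerms_check u hu) v hv
  have k1 : allFive (octRel u.1 u.2 v.1) = true := by
    rw [allFive_iff]
    intro x
    simp only [octRel, ua, ua', vb, h1, Nat.beq_refl]
  have k2 : allFive (octRel v.1 v.2 u.1) = true := by
    rw [allFive_iff]
    intro x
    simp only [octRel, ua, vb', vb, h2, Nat.beq_refl]
  rw [k1, k2] at h
  have k3 : allFive (octComm u.1 v.1) = true := by simpa using h
  rw [allFive_iff] at k3
  have := k3 x
  simp only [octComm, ua, vb] at this
  exact Fin.ext (Nat.eq_of_beq_eq_true this)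

theorem weeksGroup_index_five_subgroup_normal (H : Subgroup WeeksGroup) (hH : H.index = 5) :
    H.Normal := by
  have hc : Nat.card (WeeksGroup ⧸ H) = 5 := hH
  have : Finite (WeeksGroup ⧸ H) := Nat.finite_of_card_ne_zero (by omega)
  let e : (WeeksGroup ⧸ H) ≃ Fin 5 := Finite.equivFinOfCardEq hc
  let φ : WeeksGroup →* Equiv.Perm (Fin 5) :=
    (e.permCongrHom : _ →* _).comp (MulAction.toPermHom WeeksGroup (WeeksGroup ⧸ H))
  let A : WeeksGroup := PresentedGroup.of 0
  let B : WeeksGroup := PresentedGroup.of 1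
  have r1 : B * A * B * A * B * A⁻¹ * B ^ 2 * A⁻¹ = 1 :=
    PresentedGroup.one_of_mem (rels := weeksRels) (Or.inl rfl)
  have r2 : A * B * A * B * A * B⁻¹ * A ^ 2 * B⁻¹ = 1 :=
    PresentedGroup.one_of_mem (rels := weeksRels) (Or.inr rfl)
  have s1 := congrArg φ r1
  have s2 := congrArg φ r2
  simp only [map_mul, map_inv, map_one, pow_two] at s1 s2
  have hAB : φ A * φ B = φ B * φ A := by
    ext1 x
    exact perm_five_check (φ A) (φ B) (fun x => by simpa using Equiv.congr_fun s1 x)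
      (fun x => by simpa using Equiv.congr_fun s2 x) x
  have gen : ∀ i j : Fin 2, φ (PresentedGroup.of i) * φ (PresentedGroup.of j)
      = φ (PresentedGroup.of j) * φ (PresentedGroup.of i) := by
    intro i j
    fin_cases i <;> fin_cases j
    · rfl
    · exact hAB
    · exact hAB.symm
    · rfl
  have key : ∀ (z : Equiv.Perm (Fin 5)), (∀ i : Fin 2, Commute (φ (PresentedGroup.of i)) z) →
      ∀ g, Commute (φ g) z := by
    intro z hz g
    have hle : Subgroup.closure (Set.range (PresentedGroup.of (rels := weeksRels))) ≤
        (Subgroup.centralizer {z}).comap φ := by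
      rw [Subgroup.closure_le]
      rintro _ ⟨i, rfl⟩
      exact Subgroup.mem_centralizer_singleton_iff.2 (hz i)
    rw [PresentedGroup.closure_range_of] at hle
    exact Subgroup.mem_centralizer_singleton_iff.1 (hle (Subgroup.mem_top g))
  have comm : ∀ g h, Commute (φ g) (φ h) := fun g h =>
    key _ (fun i => (key _ (fun j => gen j i) h).symm) g
  refine ⟨fun n hn g => ?_⟩
  have h1 := Equiv.congr_fun (comm n g⁻¹) (e ((1 : WeeksGroup) : WeeksGroup ⧸ H))
  have h2 : n • (g⁻¹ • ((1 : WeeksGroup) : WeeksGroup ⧸ H)) =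
      g⁻¹ • (n • ((1 : WeeksGroup) : WeeksGroup ⧸ H)) := by
    simpa [φ, Equiv.permCongrHom] using h1
  have h3 : ((n * g⁻¹ : WeeksGroup) : WeeksGroup ⧸ H) = ((g⁻¹ * n : WeeksGroup) : WeeksGroup ⧸ H) := by
    simpa [MulAction.Quotient.smul_coe] using h2
  rw [QuotientGroup.eq] at h3
  have h4 := H.inv_mem (H.mul_mem h3 (H.inv_mem hn))
  have h5 : ((n * g⁻¹)⁻¹ * (g⁻¹ * n) * n⁻¹)⁻¹ = g * n * g⁻¹ := by group
  rwa [h5] at h4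
end

section
/- The assignment a ↦ a·b⁻¹, b ↦ a extends to a group automorphism ψ of the Weeks manifold group G. -/
/-- The generator `a` of the Weeks manifold group. -/
def a : WeeksGroup := PresentedGroup.of 0

/-- The generator `b` of the Weeks manifold group. -/
def b : WeeksGroup := PresentedGroup.of 1

/-- The first relator word. -/
def relWord {G : Type*} [Group G] (x y : G) : G :=
  y * x * y * x * y * x⁻¹ * y ^ 2 * x⁻¹

theorem relWord_fwd_one {G : Type*} [Group G] (x y : G) (h2 : relWord y x = 1) :
    relWord (x * y⁻¹) x = 1 := by
  have : relWord (x * y⁻¹) x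
      = (x * (x * y * x * y)⁻¹) * relWord y x * (x * (x * y * x * y)⁻¹)⁻¹ := by
    simp [relWord, pow_two, mul_assoc]
  rw [this, h2]; group

theorem relWord_fwd_two {G : Type*} [Group G] (x y : G) (h1 : relWord x y = 1)
    (h2 : relWord y x = 1) : relWord x (x * y⁻¹) = 1 := by
  have : relWord x (x * y⁻¹)
      = (x * (x * y * x * y * x)⁻¹) * relWord y x * (x * (x * y * x * y * x)⁻¹)⁻¹ *
        ((x * (y * x * y * x)⁻¹) * (relWord x y)⁻¹ * (x * (y * x * y * x)⁻¹)⁻¹) := by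
    simp [relWord, pow_two, mul_assoc]
  rw [this, h1, h2]; group

theorem relWord_bwd_two {G : Type*} [Group G] (x y : G) (h1 : relWord x y = 1) :
    relWord (x⁻¹ * y) y = 1 := by
  have : relWord (x⁻¹ * y) y
      = (y * x * y * x)⁻¹ * relWord x y * (y * x * y * x) := by
    simp [relWord, pow_two, mul_assoc]
  rw [this, h1]; group

theorem relWord_bwd_one {G : Type*} [Group G] (x y : G) (h1 : relWord x y = 1)
    (h2 : relWord y x = 1) : relWord y (x⁻¹ * y) = 1 := by
  have : relWord y (x⁻¹ * y)
      = (y * x * y * x * y)⁻¹ * relWord x y * (y * x * y * x * y) *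
        ((x * y * x * y)⁻¹ * (relWord y x)⁻¹ * (x * y * x * y)) := by
    simp [relWord, pow_two, mul_assoc]
  rw [this, h1, h2]; group

theorem weeks_rel_one : relWord a b = 1 :=
  PresentedGroup.one_of_mem (rels := weeksRels) (Or.inl rfl)

theorem weeks_rel_two : relWord b a = 1 :=
  PresentedGroup.one_of_mem (rels := weeksRels) (Or.inr rfl)

theorem weeks_lift_aux {G : Type*} [Group G] (x y : G) (h1 : relWord x y = 1)
    (h2 : relWord y x = 1) : ∀ r ∈ weeksRels, FreeGroup.lift ![x, y] r = 1 := by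
  rintro r (rfl | rfl)
  · simpa [relWord] using h1
  · simpa [relWord] using h2

theorem weeks_exists_hom {G : Type*} [Group G] (x y : G) (h1 : relWord x y = 1)
    (h2 : relWord y x = 1) : ∃ f : WeeksGroup →* G, f a = x ∧ f b = y :=
  ⟨PresentedGroup.toGroup (weeks_lift_aux x y h1 h2),
    PresentedGroup.toGroup.of _, PresentedGroup.toGroup.of _⟩

theorem weeks_hom_ext (f : WeeksGroup →* WeeksGroup) (ha : f a = a) (hb : f b = b) :
    f = MonoidHom.id _ := by
  apply PresentedGroup.ext
  intro i
  fin_cases i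
  · exact ha
  · exact hb

theorem weeksGroup_psi_automorphism :
    ∃ ψ : WeeksGroup ≃* WeeksGroup, ψ a = a * b⁻¹ ∧ ψ b = a := by
  obtain ⟨f, fa, fb⟩ := weeks_exists_hom (a * b⁻¹) a
    (relWord_fwd_one a b weeks_rel_two) (relWord_fwd_two a b weeks_rel_one weeks_rel_two)
  obtain ⟨g, ga, gb⟩ := weeks_exists_hom b (a⁻¹ * b)
    (relWord_bwd_one a b weeks_rel_one weeks_rel_two) (relWord_bwd_two a b weeks_rel_one)
  refine ⟨MonoidHom.toMulEquiv f g (weeks_hom_ext _ ?_ ?_) (weeks_hom_ext _ ?_ ?_), fa, fb⟩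
  · rw [MonoidHom.comp_apply, fa, map_mul, map_inv, ga, gb]; group
  · rw [MonoidHom.comp_apply, fb, ga]
  · rw [MonoidHom.comp_apply, ga, fb]
  · rw [MonoidHom.comp_apply, gb, map_mul, map_inv, fa, fb]; group
end

section
/- In the Weeks manifold group G, the identity (a·b)·(a⁻¹·b⁻¹)³·(a·b⁻¹·a⁻²)³ = 1 holds. -/
/-- First relation in the Weeks group, solved for the inverse of `babab`. -/
theorem weeks_rel_one_s9 : b⁻¹ * a⁻¹ * b⁻¹ * a⁻¹ * b⁻¹ = a⁻¹ * b * b * a⁻¹ := by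
  have h : b * a * b * a * b * a⁻¹ * b ^ 2 * a⁻¹ = 1 :=
    PresentedGroup.one_of_mem (rels := weeksRels) (Or.inl rfl)
  have h2 := eq_inv_of_mul_eq_one_right (a := b * a * b * a * b) (b := a⁻¹ * b * b * a⁻¹)
    (by rw [← h]; simp only [pow_succ, pow_zero, one_mul, mul_assoc])
  rw [h2]; group

/-- Second relation in the Weeks group, solved for the inverse of `ababa`. -/
theorem weeks_rel_two_s9 : a⁻¹ * b⁻¹ * a⁻¹ * b⁻¹ * a⁻¹ = b⁻¹ * a * a * b⁻¹ := by
  have h : a * b * a * b * a * b⁻¹ * a ^ 2 * b⁻¹ = 1 :=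
    PresentedGroup.one_of_mem (rels := weeksRels) (Or.inr rfl)
  have h2 := eq_inv_of_mul_eq_one_right (a := a * b * a * b * a) (b := b⁻¹ * a * a * b⁻¹)
    (by rw [← h]; simp only [pow_succ, pow_zero, one_mul, mul_assoc])
  rw [h2]; group

theorem weeksGroup_word_identity' :
    (a * b) * (a⁻¹ * b⁻¹) ^ 3 * (a * b⁻¹ * (a ^ 2)⁻¹) ^ 3 = 1 := by
  calc
    _ = a * b * (a⁻¹ * b⁻¹ * a⁻¹ * b⁻¹ * a⁻¹) * b⁻¹ * a *
        (b⁻¹ * a⁻¹ * b⁻¹ * a⁻¹ * b⁻¹) * a⁻¹ * a⁻¹ := by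
      simp only [pow_succ, pow_zero, one_mul]; group
    _ = 1 := by
      rw [weeks_rel_one_s9, weeks_rel_two_s9]; group
end

section
/- The abelianization of the Weeks manifold group G is isomorphic to ℤ/5ℤ × ℤ/5ℤ. -/
/-- The map to `(ℤ/5)²`, on generators. -/
def weeksGen : Fin 2 → Multiplicative (ZMod 5 × ZMod 5) :=
  ![Multiplicative.ofAdd (1, 0), Multiplicative.ofAdd (0, 1)]

theorem weeksGen_rels : ∀ r ∈ weeksRels, FreeGroup.lift weeksGen r = 1 := by
  intro r hr
  rcases hr with rfl | rfl <;>
  · simp only [map_mul, map_inv, map_pow, FreeGroup.lift_apply_of]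
    decide

def weeksTo : Abelianization WeeksGroup →* Multiplicative (ZMod 5 × ZMod 5) :=
  Abelianization.lift (PresentedGroup.toGroup weeksGen_rels)

def weeksAb (i : Fin 2) : Abelianization WeeksGroup :=
  Abelianization.of (PresentedGroup.of i)

theorem weeks_word {A : Type*} [AddCommGroup A] (x y : A) :
    5 • y = y + x + y + x + y + -x + 2 • y + -x := by
  abel

theorem weeksAb_one_pow : weeksAb 1 ^ 5 = 1 := by
  have h := PresentedGroup.one_of_mem (rels := weeksRels) (Or.inl rfl)
  have h2 := congrArg (Abelianization.of (G := WeeksGroup)) h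
  simp only [map_mul, map_inv, map_pow, map_one] at h2
  change weeksAb 1 * weeksAb 0 * weeksAb 1 * weeksAb 0 * weeksAb 1 * (weeksAb 0)⁻¹ *
    weeksAb 1 ^ 2 * (weeksAb 0)⁻¹ = 1 at h2
  rw [← h2]
  exact weeks_word (A := Additive (Abelianization WeeksGroup)) (weeksAb 0) (weeksAb 1)
  

theorem weeksAb_zero_pow : weeksAb 0 ^ 5 = 1 := by
  have h := PresentedGroup.one_of_mem (rels := weeksRels) (Or.inr rfl)
  have h2 := congrArg (Abelianization.of (G := WeeksGroup)) h
  simp only [map_mul, map_inv, map_pow, map_one] at h2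
  change weeksAb 0 * weeksAb 1 * weeksAb 0 * weeksAb 1 * weeksAb 0 * (weeksAb 1)⁻¹ *
    weeksAb 0 ^ 2 * (weeksAb 1)⁻¹ = 1 at h2
  rw [← h2]
  exact weeks_word (A := Additive (Abelianization WeeksGroup)) (weeksAb 1) (weeksAb 0)

theorem weeksAb_pow (i : Fin 2) : weeksAb i ^ 5 = 1 := by
  fin_cases i
  · exact weeksAb_zero_pow
  · exact weeksAb_one_pow

/-- The homomorphism `ℤ/5 → G^ab` hitting generator `i`. -/
def weeksFromAux (i : Fin 2) : ZMod 5 →+ Additive (Abelianization WeeksGroup) :=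
  ZMod.lift 5 ⟨zmultiplesHom _ (Additive.ofMul (weeksAb i)), by
    rw [zmultiplesHom_apply, natCast_zsmul, ← ofMul_pow, weeksAb_pow, ofMul_one]⟩

theorem weeksFromAux_one (i : Fin 2) : weeksFromAux i 1 = Additive.ofMul (weeksAb i) := by
  have h := ZMod.lift_coe 5 (⟨zmultiplesHom _ (Additive.ofMul (weeksAb i)), by
    rw [zmultiplesHom_apply, natCast_zsmul, ← ofMul_pow, weeksAb_pow, ofMul_one]⟩ :
      {f : ℤ →+ Additive (Abelianization WeeksGroup) // f (5 : ℕ) = 0}) 1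
  simpa [weeksFromAux] using h

def weeksFrom : Multiplicative (ZMod 5 × ZMod 5) →* Abelianization WeeksGroup :=
  AddMonoidHom.toMultiplicativeLeft ((weeksFromAux 0).coprod (weeksFromAux 1))

theorem weeksTo_ab (i : Fin 2) : weeksTo (weeksAb i) = weeksGen i := by
  simp [weeksTo, weeksAb]

theorem weeksFrom_gen (i : Fin 2) : weeksFrom (weeksGen i) = weeksAb i := by
  fin_cases i <;> simp [weeksFrom, weeksGen, weeksFromAux_one]

theorem weeksGen_decomp (x : Multiplicative (ZMod 5 × ZMod 5)) :
    x = weeksGen 0 ^ (x.toAdd.1.val) * weeksGen 1 ^ (x.toAdd.2.val) := by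
  revert x
  decide

theorem weeksGroup_abelianization :
    Nonempty (Abelianization WeeksGroup ≃* Multiplicative (ZMod 5 × ZMod 5)) := by
  refine ⟨MonoidHom.toMulEquiv weeksTo weeksFrom ?_ ?_⟩
  · apply Abelianization.hom_ext
    apply PresentedGroup.ext
    intro i
    change weeksFrom (weeksTo (weeksAb i)) = weeksAb i
    rw [weeksTo_ab, weeksFrom_gen]
  · refine MonoidHom.ext fun x => ?_
    rw [weeksGen_decomp x]
    simp only [map_mul, map_pow, MonoidHom.comp_apply, weeksFrom_gen, weeksTo_ab,
      MonoidHom.id_apply]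
end

section
/- If a group G admits an injective group homomorphism into the group of orientation-preserving homeomorphisms of the real line (equivalently, the group of order-preserving bijections ℝ → ℝ), then G is left-orderable. -/
/-- The group of order-preserving bijections of `ℝ` (equivalently, orientation-preserving
homeomorphisms of the line), under composition. -/
instance : Group (ℝ ≃o ℝ) where
  mul f g := g.trans f
  one := OrderIso.refl ℝ
  inv f := f.symm
  mul_assoc _ _ _ := rfl
  one_mul _ := by ext x; rfl
  mul_one _ := by ext x; rfl
  inv_mul_cancel f := by ext x; exact f.symm_apply_apply x

theorem leftOrderable_of_faithful_action_on_R (G : Type*) [Group G]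
    (h : ∃ φ : G →* (ℝ ≃o ℝ), Function.Injective φ) : IsLeftOrderable G := by
  obtain ⟨φ, hφ⟩ := h
  -- a well-ordered index type in bijection with `ℝ`
  obtain ⟨e⟩ : Nonempty ((Cardinal.mk ℝ).ord.ToType ≃ ℝ) :=
    Cardinal.eq.mp (by simp)
  -- compare group elements lexicographically by their values along the well-order
  let F : G → Lex ((Cardinal.mk ℝ).ord.ToType → ℝ) := fun g => toLex (fun i => φ g (e i))
  have hF : Function.Injective F := by
    intro a b hab
    apply hφ
    ext x
    have := congrFun (toLex.injective hab) (e.symm x)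
    simpa using this
  refine ⟨LinearOrder.lift' F hF, ?_⟩
  intro f a b hab
  have hab' : F a < F b := hab
  show F (f * a) < F (f * b)
  have key : ∀ (c : G) (x : ℝ), φ (f * c) x = φ f (φ c x) := by
    intro c x
    rw [map_mul]
    rfl
  obtain ⟨i, hi, hlt⟩ := hab'
  refine ⟨i, fun j hj => ?_, ?_⟩
  · have h1 : φ a (e j) = φ b (e j) := hi j hj
    show φ (f * a) (e j) = φ (f * b) (e j)
    rw [key, key, h1]
  · have h1 : φ a (e i) < φ b (e i) := hlt
    show φ (f * a) (e i) < φ (f * b) (e i)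
    rw [key, key]
    exact (φ f).strictMono h1
end

section
/- If a finitely generated group G is left-orderable, then G admits an injective group homomorphism into the group of orientation-preserving homeomorphisms of the real line (the group of order-preserving bijections ℝ → ℝ under composition). -/
/-- Monotone extension to the reals of a map of the rationals. -/
noncomputable def ratExt (f : ℚ → ℚ) (x : ℝ) : ℝ :=
  sSup ((fun q : ℚ => (f q : ℝ)) '' {q : ℚ | (q : ℝ) ≤ x})

theorem ratExt_cast {f : ℚ → ℚ} (hf : Monotone f) (q : ℚ) : ratExt f q = f q := by
  apply IsGreatest.csSup_eq
  refine ⟨⟨q, by simp, rfl⟩, ?_⟩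
  rintro _ ⟨r, hr, rfl⟩
  have hr' : r ≤ q := by exact_mod_cast hr
  have := hf hr'
  exact Rat.cast_le.2 this

theorem ratExt_mono {f : ℚ → ℚ} (hf : Monotone f) : Monotone (ratExt f) := by
  intro x y hxy
  apply csSup_le_csSup
  · obtain ⟨n, hn⟩ := exists_rat_gt y
    refine ⟨(f n : ℝ), ?_⟩
    rintro _ ⟨r, hr, rfl⟩
    have hr' : r ≤ n := by
      have : (r : ℝ) ≤ n := le_trans hr hn.le
      exact_mod_cast this
    have := hf hr'
    exact Rat.cast_le.2 this
  · obtain ⟨n, hn⟩ := exists_rat_lt x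
    exact ⟨_, n, hn.le, rfl⟩
  · apply Set.image_mono
    intro q hq
    exact le_trans hq hxy

theorem eq_id_of_mono_of_rat {m : ℝ → ℝ} (hm : Monotone m) (h : ∀ q : ℚ, m q = q) (x : ℝ) :
    m x = x := by
  apply le_antisymm
  · by_contra hc
    obtain ⟨q, h1, h2⟩ := exists_rat_btwn (not_le.1 hc)
    have := hm h1.le
    rw [h] at this
    linarith
  · by_contra hc
    obtain ⟨q, h1, h2⟩ := exists_rat_btwn (not_le.1 hc)
    have := hm h2.le
    rw [h] at this
    linarith

theorem exists_hom_of_rat {G : Type*} [Group G] (ρ : G → ℚ → ℚ) (hm : ∀ g, Monotone (ρ g))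
    (h1 : ∀ q, ρ 1 q = q) (hmul : ∀ g h q, ρ (g * h) q = ρ g (ρ h q))
    (hinj : Function.Injective ρ) : ∃ φ : G →* (ℝ ≃o ℝ), Function.Injective φ := by
  have hM : ∀ g, Monotone (ratExt (ρ g)) := fun g => ratExt_mono (hm g)
  have hc : ∀ g (q : ℚ), ratExt (ρ g) q = ρ g q := fun g q => ratExt_cast (hm g) q
  have hinv : ∀ g x, ratExt (ρ g⁻¹) (ratExt (ρ g) x) = x := by
    intro g
    apply eq_id_of_mono_of_rat ((hM g⁻¹).comp (hM g))
    intro q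
    simp [hc, ← hmul, h1]
  have hinv' : ∀ g x, ratExt (ρ g) (ratExt (ρ g⁻¹) x) = x := by
    intro g x
    simpa using hinv g⁻¹ x
  have hcomp : ∀ g h x, ratExt (ρ (g * h)) x = ratExt (ρ g) (ratExt (ρ h) x) := by
    intro g h x
    have key : ratExt (ρ h⁻¹) (ratExt (ρ g⁻¹) (ratExt (ρ (g * h)) x)) = x := by
      revert x
      apply eq_id_of_mono_of_rat ((hM h⁻¹).comp ((hM g⁻¹).comp (hM (g * h))))
      intro q
      simp only [Function.comp, hc, ← hmul]
      simp [h1]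
    conv_rhs => rw [← key]
    rw [hinv', hinv']
  let F : G → (ℝ ≃o ℝ) := fun g =>
    Equiv.toOrderIso ⟨ratExt (ρ g), ratExt (ρ g⁻¹), hinv g, hinv' g⟩ (hM g) (hM g⁻¹)
  refine ⟨MonoidHom.mk' F ?_, ?_⟩
  · intro g h
    ext x
    exact hcomp g h x
  · intro g h hgh
    apply hinj
    funext q
    have : F g (q : ℝ) = F h (q : ℝ) := by
      have h' : F g = F h := hgh
      rw [h']
    have h2 : ratExt (ρ g) q = ratExt (ρ h) q := this
    rw [hc, hc] at h2
    exact_mod_cast h2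

theorem faithful_action_on_R_of_leftOrderable (G : Type*) [Group G] [Group.FG G]
    (h : IsLeftOrderable G) : ∃ φ : G →* (ℝ ≃o ℝ), Function.Injective φ := by
  obtain ⟨_, hlt⟩ := h
  have hG : Countable G := by
    obtain ⟨S, hS, φ, hφ⟩ := Group.fg_iff_exists_freeGroup_hom_surjective.1 ‹Group.FG G›
    have := hS.countable.to_subtype
    have : Countable (FreeGroup S) := Quot.mk_surjective.countable
    exact hφ.countable
  have : Countable (G ×ₗ ℚ) := inferInstanceAs (Countable (G × ℚ))
  obtain ⟨e⟩ := Order.iso_of_countable_dense (G ×ₗ ℚ) ℚ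
  let a : G → (G ×ₗ ℚ) → (G ×ₗ ℚ) := fun g p => toLex (g * (ofLex p).1, (ofLex p).2)
  have ha : ∀ g, Monotone (a g) := by
    intro g x y hxy
    rw [Prod.Lex.le_iff] at hxy ⊢
    rcases hxy with h | ⟨h, h'⟩
    · exact Or.inl (hlt _ _ _ h)
    · exact Or.inr ⟨congrArg (g * ·) h, h'⟩
  apply exists_hom_of_rat (fun g q => e (a g (e.symm q)))
  · intro g x y hxy
    exact e.monotone (ha g (e.symm.monotone hxy))
  · intro q
    simp [a]
  · intro g h q
    simp [a, mul_assoc]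
  · intro g h hgh
    have := congrFun hgh (e (toLex (1, 0)))
    simpa [a] using this
end

section
/- Let F be a free group of finite rank n ≥ 1. The set of injective group homomorphisms from F to PSL(2,ℝ) is dense in the space of all group homomorphisms F → PSL(2,ℝ), where this space is identified with the product PSL(2,ℝ)ⁿ (a homomorphism is determined by the images of the n free generators) with the product topology. -/
open scoped MatrixGroups

/-- The topology on `SL(2,ℝ)`, as a subspace of the space of `2 × 2` real matrices. -/
instance : TopologicalSpace (Matrix.SpecialLinearGroup (Fin 2) ℝ) :=
  instTopologicalSpaceSubtype

open Polynomial UpperHalfPlane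

noncomputable section

namespace DenseFree

/-- The Schottky generator `z ↦ d - 1 / (z - c)`. -/
def sch (c d : ℝ) : SL(2, ℝ) := ⟨!![d, -1 - c * d; 1, -c], by simp [Matrix.det_fin_two]; ring⟩

lemma sch_smul (c d : ℝ) (z : ℍ) : ((sch c d • z : ℍ) : ℂ) - d = -((z : ℂ) - c)⁻¹ := by
  have hz : (z : ℂ) - c ≠ 0 := by
    intro h
    have := congrArg Complex.im h
    simp at this
    exact z.im_pos.ne' this
  rw [UpperHalfPlane.coe_specialLinearGroup_apply]
  have h2 : (z : ℂ) + -c ≠ 0 := by simpa [sub_eq_add_neg] using hz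
  simp [sch]
  field_simp
  rw [sub_eq_add_neg]
  field_simp
  ring

lemma sch_inv_smul (c d : ℝ) (z : ℍ) :
    (((sch c d)⁻¹ • z : ℍ) : ℂ) - c = -((z : ℂ) - d)⁻¹ := by
  have h := sch_smul c d ((sch c d)⁻¹ • z)
  rw [smul_inv_smul] at h
  rw [h]
  simp

/-- Closed half-disc of radius one. -/
def disc (c : ℝ) : Set ℍ := {z | ‖(z : ℂ) - c‖ ≤ 1}

lemma disc_nonempty (c : ℝ) : (disc c).Nonempty :=
  ⟨⟨c + Complex.I, by simp⟩, by simp [disc]⟩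

lemma disc_disjoint {c d : ℝ} (h : 2 < |c - d|) : Disjoint (disc c) (disc d) := by
  rw [Set.disjoint_left]
  intro z h1 h2
  simp only [disc, Set.mem_ofPred_eq] at h1 h2
  have h3 : ‖((c - d : ℝ) : ℂ)‖ ≤ ‖(z : ℂ) - d‖ + ‖(z : ℂ) - c‖ := by
    have : ((c - d : ℝ) : ℂ) = ((z : ℂ) - d) - ((z : ℂ) - c) := by push_cast; ring
    rw [this]
    exact norm_sub_le _ _
  rw [Complex.norm_real, Real.norm_eq_abs] at h3
  linarith

lemma two_lt_abs {a b : ℤ} (h : 3 ≤ |a - b|) : (2 : ℝ) < |(a : ℝ) - b| := by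
  have : (3 : ℝ) ≤ |(a : ℝ) - b| := by exact_mod_cast h
  linarith

/-- the free family -/
def fam (k : ℕ) : SL(2, ℝ) := sch ((6 * k : ℤ) : ℝ) ((6 * k + 3 : ℤ) : ℝ)

lemma fam_injective : Function.Injective (FreeGroup.lift fam) := by
  refine FreeGroup.injective_lift_of_ping_pong fam (α := ℍ)
    (fun k => disc ((6 * k + 3 : ℤ) : ℝ)) (fun k => disc ((6 * k : ℤ) : ℝ))
    (fun k => disc_nonempty _) ?_ ?_ ?_ ?_ ?_
  · intro i j hij
    apply disc_disjoint
    apply two_lt_abs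
    rw [le_abs]; omega
  · intro i j hij
    apply disc_disjoint
    apply two_lt_abs
    rw [le_abs]; omega
  · intro i j
    apply disc_disjoint
    apply two_lt_abs
    rw [le_abs]; omega
  · rintro i _ ⟨z, hz, rfl⟩
    simp only [disc, Set.mem_compl_iff, Set.mem_ofPred_eq, not_le] at hz
    change ‖((fam i • z : ℍ) : ℂ) - _‖ ≤ 1
    rw [fam, sch_smul, norm_neg, norm_inv]
    exact inv_le_one_of_one_le₀ hz.le
  · rintro i _ ⟨z, hz, rfl⟩
    simp only [disc, Set.mem_compl_iff, Set.mem_ofPred_eq, not_le] at hz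
    change ‖(((fam i)⁻¹ • z : ℍ) : ℂ) - _‖ ≤ 1
    rw [fam, sch_inv_smul, norm_neg, norm_inv]
    exact inv_le_one_of_one_le₀ hz.le

/-- upper and lower transvections -/
def up {R : Type*} [CommRing R] (x : R) : SL(2, R) := ⟨!![1, x; 0, 1], by simp⟩
def lo {R : Type*} [CommRing R] (x : R) : SL(2, R) := ⟨!![1, 0; x, 1], by simp⟩

lemma decomp_aux (g : SL(2, ℝ)) (h : g 1 0 ≠ 0) : ∃ x y z, g = up x * lo y * up z := by
  have hd := g.det_coe
  rw [Matrix.det_fin_two] at hd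
  refine ⟨(g 0 0 - 1) / g 1 0, g 1 0, (g 1 1 - 1) / g 1 0, ?_⟩
  ext i j
  rw [Matrix.SpecialLinearGroup.coe_mul, Matrix.SpecialLinearGroup.coe_mul]
  fin_cases i <;> fin_cases j <;> simp [up, lo, Matrix.mul_apply, Fin.sum_univ_two] <;>
    field_simp <;> linarith

lemma decomp (g : SL(2, ℝ)) : ∃ x y z w, g = up x * lo y * up z * lo w := by
  by_cases h : g 1 0 = 0
  · have hd := g.det_coe
    rw [Matrix.det_fin_two, h] at hd
    have h1 : (g * lo 1 : SL(2, ℝ)) 1 0 ≠ 0 := by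
      rw [Matrix.SpecialLinearGroup.coe_mul]
      simp [lo, Matrix.mul_apply, Fin.sum_univ_two, h]
      intro hz
      simp [hz] at hd
    obtain ⟨x, y, z, e⟩ := decomp_aux _ h1
    refine ⟨x, y, z, -1, ?_⟩
    rw [← e, mul_assoc]
    have : (lo 1 * lo (-1) : SL(2, ℝ)) = 1 := by
      ext i j
      rw [Matrix.SpecialLinearGroup.coe_mul]
      fin_cases i <;> fin_cases j <;> simp [lo, Matrix.mul_apply, Fin.sum_univ_two]
    rw [this, mul_one]
  · obtain ⟨x, y, z, e⟩ := decomp_aux _ h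
    refine ⟨x, y, z, 0, ?_⟩
    have : (lo 0 : SL(2, ℝ)) = 1 := by
      ext i j
      fin_cases i <;> fin_cases j <;> simp [lo]
    rw [this, mul_one, e]

/-- evaluation of polynomial matrices -/
def ev (t : ℝ) : SL(2, ℝ[X]) →* SL(2, ℝ) := Matrix.SpecialLinearGroup.map (evalRingHom t)

lemma ev_apply (t : ℝ) (A : SL(2, ℝ[X])) (i j : Fin 2) : (ev t A) i j = (A i j).eval t := rfl

lemma ev_up (t : ℝ) (p : ℝ[X]) : ev t (up p) = up (p.eval t) := by
  ext i j
  rw [ev_apply]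
  fin_cases i <;> fin_cases j <;> simp [up]

lemma ev_lo (t : ℝ) (p : ℝ[X]) : ev t (lo p) = lo (p.eval t) := by
  ext i j
  rw [ev_apply]
  fin_cases i <;> fin_cases j <;> simp [lo]

lemma exists_path (g h : SL(2, ℝ)) : ∃ A : SL(2, ℝ[X]), ev 0 A = g ∧ ev 1 A = h := by
  obtain ⟨x, y, z, w, rfl⟩ := decomp g
  obtain ⟨x₁, y₁, z₁, w₁, rfl⟩ := decomp h
  refine ⟨up (C x + C (x₁ - x) * X) * lo (C y + C (y₁ - y) * X) *
    up (C z + C (z₁ - z) * X) * lo (C w + C (w₁ - w) * X), ?_, ?_⟩ <;>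
  simp [ev_up, ev_lo]

lemma continuous_ev (A : SL(2, ℝ[X])) : Continuous fun t => ev t A := by
  refine Continuous.subtype_mk (f := fun t => ((ev t A : SL(2, ℝ)) : Matrix (Fin 2) (Fin 2) ℝ)) ?_ _
  refine continuous_matrix fun i j => ?_
  exact (A i j).continuous

lemma mem_center_iff' (A : SL(2, ℝ)) :
    A ∈ Subgroup.center SL(2, ℝ) ↔ A 0 1 = 0 ∧ A 1 0 = 0 ∧ A 0 0 - A 1 1 = 0 := by
  rw [Matrix.SpecialLinearGroup.mem_center_iff]
  constructor
  · rintro ⟨r, -, h⟩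
    simp [← h]
  · rintro ⟨h1, h2, h3⟩
    have hd := A.det_coe
    rw [Matrix.det_fin_two, h1, h2] at hd
    have h4 : A 1 1 = A 0 0 := by linarith
    refine ⟨A 0 0, ?_, ?_⟩
    · rw [h4] at hd
      rw [Fintype.card_fin]
      linarith
    · ext i j
      fin_cases i <;> fin_cases j <;> simp [h1, h2, h4]

lemma finite_bad (A : SL(2, ℝ[X])) (h : ev 1 A ∉ Subgroup.center SL(2, ℝ)) :
    {t | ev t A ∈ Subgroup.center SL(2, ℝ)}.Finite := by
  have key : ∀ p : ℝ[X], p.eval 1 ≠ 0 → {t | p.eval t = 0}.Finite := by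
    intro p hp
    have hp0 : p ≠ 0 := by rintro rfl; simp at hp
    exact p.finite_setOfPred_isRoot hp0
  have hm : ∀ t, ev t A ∈ Subgroup.center SL(2, ℝ) ↔
      (A 0 1).eval t = 0 ∧ (A 1 0).eval t = 0 ∧ (A 0 0 - A 1 1).eval t = 0 := by
    intro t
    rw [mem_center_iff', eval_sub]
    rfl
  simp only [hm] at h ⊢
  by_cases h1 : (A 0 1).eval 1 = 0
  · by_cases h2 : (A 1 0).eval 1 = 0
    · have h3 : (A 0 0 - A 1 1).eval 1 ≠ 0 := fun h3 => h ⟨h1, h2, h3⟩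
      exact (key _ h3).subset fun t ht => ht.2.2
    · exact (key _ h2).subset fun t ht => ht.2.1
  · exact (key _ h1).subset fun t ht => ht.1

lemma fam_center (n : ℕ) (w : FreeGroup (Fin n)) (hw : w ≠ 1) :
    FreeGroup.lift (fun i : Fin n => fam i) w ∉ Subgroup.center SL(2, ℝ) := by
  intro h
  have hinj : Function.Injective (FreeGroup.lift (fun i : Fin n => fam i)) := by
    have : FreeGroup.lift (fun i : Fin n => fam i) =
        (FreeGroup.lift fam).comp (FreeGroup.map Fin.val) := by
      ext i
      simp
    rw [this]
    exact fam_injective.comp (FreeGroup.map_injective Fin.val_injective)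
  rw [Matrix.SpecialLinearGroup.mem_center_iff] at h
  obtain ⟨r, hr, h⟩ := h
  have h2 : FreeGroup.lift (fun i : Fin n => fam i) (w ^ 2) = 1 := by
    rw [map_pow]
    apply Subtype.ext
    rw [Matrix.SpecialLinearGroup.coe_pow, ← h, ← map_pow]
    rw [Fintype.card_fin] at hr
    rw [hr, map_one, Matrix.SpecialLinearGroup.coe_one]
  have h3 : w ^ 2 = 1 := hinj (by rw [h2, map_one])
  exact hw (by simpa using h3)

end DenseFree

end

open DenseFree

/-- Identifying `Hom(Fₙ, PSL(2,ℝ))` with `PSL(2,ℝ)ⁿ` (with the product topology) via evaluation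
on the free generators, the set of injective homomorphisms is dense. -/
theorem dense_injective_homs_freeGroup_to_PSL2R (n : ℕ) (hn : 1 ≤ n) :
    Dense {v : Fin n → PSL(2, ℝ) |
      Function.Injective (FreeGroup.lift v : FreeGroup (Fin n) →* PSL(2, ℝ))} := by
  intro v
  choose g hg using fun i => QuotientGroup.mk_surjective (v i)
  choose A hA0 hA1 using fun i : Fin n => exists_path (g i) (fam i)
  let γ : ℝ → Fin n → PSL(2, ℝ) := fun t i => QuotientGroup.mk (ev t (A i))
  have hγ : Continuous γ := by
    refine continuous_pi fun i => ?_
    exact continuous_quot_mk.comp (continuous_ev (A i))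
  have hγ0 : γ 0 = v := by
    funext i
    simp only [γ, hA0, hg]
  have hev : ∀ t w, ev t (FreeGroup.lift A w) = FreeGroup.lift (fun i => ev t (A i)) w := by
    intro t w
    have : (ev t).comp (FreeGroup.lift A) = FreeGroup.lift (fun i => ev t (A i)) := by
      ext i : 1
      simp
    rw [← this]; rfl
  have hlift : ∀ t w, FreeGroup.lift (γ t) w = QuotientGroup.mk (ev t (FreeGroup.lift A w)) := by
    intro t w
    have : FreeGroup.lift (γ t) =
        (QuotientGroup.mk' (Subgroup.center SL(2, ℝ))).comp ((ev t).comp (FreeGroup.lift A)) := by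
      ext i : 1
      simp [γ]
    rw [this]; rfl
  let B : Set ℝ := ⋃ w : {w : FreeGroup (Fin n) // w ≠ 1},
    {t | ev t (FreeGroup.lift A w.1) ∈ Subgroup.center SL(2, ℝ)}
  have hB : B.Countable := by
    have : Countable (FreeGroup (Fin n)) := by
      unfold FreeGroup; infer_instance
    refine Set.countable_iUnion fun w => (finite_bad _ ?_).countable
    rw [hev]
    simp only [hA1]
    exact fam_center n w.1 w.2
  have hd := hB.dense_compl ℝ
  have h0 : γ 0 ∈ closure (γ '' Bᶜ) :=
    image_closure_subset_closure_image hγ ⟨0, hd 0, rfl⟩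
  rw [hγ0] at h0
  refine closure_mono ?_ h0
  rintro _ ⟨t, ht, rfl⟩
  change Function.Injective (FreeGroup.lift (γ t))
  rw [injective_iff_map_eq_one]
  intro w hw
  by_contra hne
  rw [hlift, QuotientGroup.eq_one_iff] at hw
  exact ht (Set.mem_iUnion.2 ⟨⟨w, hne⟩, hw⟩)
end
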